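/- Fix τ ∈ (−1,1) with τ ≠ 0. If p : [0,1]² → ℝ is a twice continuously differentiable copula density (p > 0, uniform marginals) with Kendall's τ functional K(p) = ∫₀¹∫₀¹∫₀¹∫₀¹ sgn(u−ũ) sgn(v−ṽ) p(u,v) p(ũ,ṽ) du dv dũ dṽ equal to τ, and p minimizes the Shannon information ∫₀¹∫₀¹ p log p over all such densities, then there exists θ ≠ 0 such that p equals the Frank copula density c_θ(u,v) = θ(1−e^{−θ})e^{−θ(u+v)} / [1 − e^{−θ} − (1−e^{−θu})(1−e^{−θv})]²; moreover θ = 4λ where λ is the Lagrange multiplier for which p satisfies ∂²/∂u∂v log p = 8λ p. -/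

import Mathlib

/-- The Frank copula density with parameter `θ ≠ 0`. -/
noncomputable def frankDensity (θ u v : ℝ) : ℝ :=
  θ * (1 - Real.exp (-θ)) * Real.exp (-θ * (u + v)) /
    (1 - Real.exp (-θ) - (1 - Real.exp (-θ * u)) * (1 - Real.exp (-θ * v))) ^ 2

/-- A bivariate copula density: twice continuously differentiable on `[0,1]²`,
positive, with uniform marginals. -/
structure IsCopulaDensity (p : ℝ → ℝ → ℝ) : Prop where
  smooth : ContDiffOn ℝ 2 (Function.uncurry p) (Set.Icc 0 1 ×ˢ Set.Icc 0 1)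
  pos : ∀ u ∈ Set.Icc (0 : ℝ) 1, ∀ v ∈ Set.Icc (0 : ℝ) 1, 0 < p u v
  margU : ∀ v ∈ Set.Icc (0 : ℝ) 1, (∫ u in (0 : ℝ)..1, p u v) = 1
  margV : ∀ u ∈ Set.Icc (0 : ℝ) 1, (∫ v in (0 : ℝ)..1, p u v) = 1

/-- The Kendall's τ functional of a bivariate density on the unit square. -/
noncomputable def kendallTau (p : ℝ → ℝ → ℝ) : ℝ :=
  ∫ u in (0 : ℝ)..1, ∫ v in (0 : ℝ)..1, ∫ u' in (0 : ℝ)..1, ∫ v' in (0 : ℝ)..1,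
    Real.sign (u - u') * Real.sign (v - v') * p u v * p u' v'

/-- The Shannon information (negative entropy) of a bivariate density. -/
noncomputable def shannonInfo (p : ℝ → ℝ → ℝ) : ℝ :=
  ∫ u in (0 : ℝ)..1, ∫ v in (0 : ℝ)..1, p u v * Real.log (p u v)

namespace MICK

open MeasureTheory Set Filter Topology

/-- The closed unit square. -/
abbrev unitSquare : Set (ℝ × ℝ) := Icc 0 1 ×ˢ Icc 0 1

/-- Lebesgue measure on the unit interval. -/
noncomputable abbrev intervalMeasure : Measure ℝ := volume.restrict (Ioc (0 : ℝ) 1)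

/-- Lebesgue measure on the unit square. -/
noncomputable abbrev squareMeasure : Measure (ℝ × ℝ) := intervalMeasure.prod intervalMeasure

lemma integral_zero_one (f : ℝ → ℝ) : ∫ x in (0 : ℝ)..1, f x = ∫ x, f x ∂intervalMeasure :=
  intervalIntegral.integral_of_le zero_le_one

lemma squareMeasure_eq :
    squareMeasure = (volume : Measure (ℝ × ℝ)).restrict (Ioc (0 : ℝ) 1 ×ˢ Ioc (0 : ℝ) 1) :=
  Measure.prod_restrict _ _

lemma ae_mem_unitSquare : ∀ᵐ z ∂squareMeasure, z ∈ unitSquare := by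
  rw [squareMeasure_eq]
  filter_upwards [ae_restrict_mem (measurableSet_Ioc.prod measurableSet_Ioc)] with z hz
  exact ⟨Ioc_subset_Icc_self hz.1, Ioc_subset_Icc_self hz.2⟩

lemma isCompact_unitSquare : IsCompact unitSquare := isCompact_Icc.prod isCompact_Icc

lemma integrable_of_continuousOn {F : ℝ × ℝ → ℝ} (hF : ContinuousOn F unitSquare) :
    Integrable F squareMeasure := by
  rw [squareMeasure_eq]
  exact (hF.integrableOn_compact isCompact_unitSquare).mono_set
    (prod_mono Ioc_subset_Icc_self Ioc_subset_Icc_self)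

lemma integral_integral_zero_one {F : ℝ × ℝ → ℝ} (hF : Integrable F squareMeasure) :
    ∫ u in (0 : ℝ)..1, ∫ v in (0 : ℝ)..1, F (u, v) = ∫ z, F z ∂squareMeasure := by
  simp only [integral_zero_one]
  exact (integral_prod F hF).symm

lemma measurable_realSign : Measurable Real.sign := by
  unfold Real.sign
  exact Measurable.ite measurableSet_Iio measurable_const
    (Measurable.ite measurableSet_Ioi measurable_const measurable_const)

lemma abs_realSign_le (x : ℝ) : |Real.sign x| ≤ 1 := by
  rcases Real.sign_apply_eq x with h | h | h <;> simp [h]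

/-- The concordance kernel underlying Kendall's τ. -/
noncomputable def concordance (w : (ℝ × ℝ) × (ℝ × ℝ)) : ℝ :=
  Real.sign (w.1.1 - w.2.1) * Real.sign (w.1.2 - w.2.2)

lemma measurable_concordance : Measurable concordance :=
  (measurable_realSign.comp (by fun_prop)).mul (measurable_realSign.comp (by fun_prop))

lemma abs_concordance_le (w : (ℝ × ℝ) × (ℝ × ℝ)) : |concordance w| ≤ 1 := by
  rw [concordance, abs_mul]
  exact mul_le_one₀ (abs_realSign_le _) (abs_nonneg _) (abs_realSign_le _)

lemma concordance_swap (w : (ℝ × ℝ) × (ℝ × ℝ)) : concordance w.swap = concordance w := by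
  simp only [concordance, Prod.fst_swap, Prod.snd_swap]
  rw [← neg_sub w.1.1, ← neg_sub w.1.2, Real.sign_neg, Real.sign_neg, neg_mul_neg]

/-- The bilinear form whose diagonal is Kendall's τ. -/
noncomputable def kendallForm (F G : ℝ × ℝ → ℝ) : ℝ :=
  ∫ w, concordance w * (F w.1 * G w.2) ∂(squareMeasure.prod squareMeasure)

lemma integrable_kendall {F G : ℝ × ℝ → ℝ} (hF : Integrable F squareMeasure)
    (hG : Integrable G squareMeasure) :
    Integrable (fun w : (ℝ × ℝ) × (ℝ × ℝ) => concordance w * (F w.1 * G w.2))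
      (squareMeasure.prod squareMeasure) :=
  (hF.mul_prod hG).bdd_mul measurable_concordance.aestronglyMeasurable
    (.of_forall abs_concordance_le)

lemma kendallTau_eq {p : ℝ → ℝ → ℝ} (hp : Integrable (Function.uncurry p) squareMeasure) :
    kendallTau p = kendallForm (Function.uncurry p) (Function.uncurry p) := by
  have h := integrable_kendall hp hp
  rw [kendallForm, integral_prod _ h, ← integral_integral_zero_one h.integral_prod_left]
  refine intervalIntegral.integral_congr fun u _ => intervalIntegral.integral_congr fun v _ => ?_
  have hi : Integrable (fun z : ℝ × ℝ => concordance ((u, v), z) *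
      (Function.uncurry p (u, v) * Function.uncurry p z)) squareMeasure :=
    (hp.const_mul _).bdd_mul
      (measurable_concordance.comp (by fun_prop)).aestronglyMeasurable
      (.of_forall fun z => abs_concordance_le _)
  simp only
  rw [← integral_integral_zero_one hi]
  simp only [concordance, Function.uncurry, mul_assoc]

lemma kendallForm_comm (F G : ℝ × ℝ → ℝ) : kendallForm F G = kendallForm G F := by
  rw [kendallForm, ← integral_prod_swap]
  refine integral_congr_ae (.of_forall fun w => ?_)
  simp only [concordance_swap, Prod.fst_swap, Prod.snd_swap]
  ring

lemma kendallForm_add_left {F G H : ℝ × ℝ → ℝ} (hF : Integrable F squareMeasure)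
    (hG : Integrable G squareMeasure) (hH : Integrable H squareMeasure) :
    kendallForm (F + G) H = kendallForm F H + kendallForm G H := by
  rw [kendallForm, kendallForm, kendallForm,
    ← integral_add (integrable_kendall hF hH) (integrable_kendall hG hH)]
  refine integral_congr_ae (.of_forall fun w => ?_)
  simp only [Pi.add_apply]
  ring

lemma kendallForm_smul_left (c : ℝ) (F H : ℝ × ℝ → ℝ) :
    kendallForm (c • F) H = c * kendallForm F H := by
  rw [kendallForm, kendallForm, ← integral_const_mul]
  refine integral_congr_ae (.of_forall fun w => ?_)
  simp only [Pi.smul_apply, smul_eq_mul]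
  ring

lemma kendallForm_add_self {F G : ℝ × ℝ → ℝ} (hF : Integrable F squareMeasure)
    (hG : Integrable G squareMeasure) :
    kendallForm (F + G) (F + G) =
      kendallForm F F + 2 * kendallForm G F + kendallForm G G := by
  rw [kendallForm_add_left hF hG (hF.add hG), kendallForm_comm F, kendallForm_comm G,
    kendallForm_add_left hF hG hF, kendallForm_add_left hF hG hG, kendallForm_comm F G]
  ring

/-- A potential whose derivative has mean zero and is usable as a perturbation factor. -/
structure IsPotential (A : ℝ → ℝ) : Prop where
  contDiff : ContDiff ℝ 3 A
  map_zero : A 0 = 0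
  map_one : A 1 = 0

namespace IsPotential

variable {A B : ℝ → ℝ}

lemma hasDerivAt (hA : IsPotential A) (x : ℝ) : HasDerivAt A (deriv A x) x :=
  (hA.contDiff.differentiable (by norm_num) x).hasDerivAt

lemma contDiff_deriv (hA : IsPotential A) : ContDiff ℝ 2 (deriv A) :=
  (contDiff_succ_iff_deriv.1 (show ContDiff ℝ (2 + 1) A by exact_mod_cast hA.contDiff)).2.2

lemma integral_deriv (hA : IsPotential A) (a b : ℝ) : ∫ x in a..b, deriv A x = A b - A a :=
  intervalIntegral.integral_eq_sub_of_hasDerivAt (fun x _ => hA.hasDerivAt x)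
    (hA.contDiff_deriv.continuous.intervalIntegrable _ _)

lemma integral_sign_mul_deriv (hA : IsPotential A) {x : ℝ} (hx : x ∈ Icc (0 : ℝ) 1) :
    ∫ u, Real.sign (u - x) * deriv A u ∂intervalMeasure = -2 * A x := by
  have hc := hA.contDiff_deriv.continuous
  have hi : ∀ a b, IntervalIntegrable (fun u => Real.sign (u - x) * deriv A u) volume a b := by
    intro a b
    rw [intervalIntegrable_iff]
    exact (intervalIntegrable_iff.1 (hc.intervalIntegrable a b)).bdd_mul
      (measurable_realSign.comp (by fun_prop)).aestronglyMeasurable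
      (.of_forall fun u => abs_realSign_le _)
  rw [← integral_zero_one, ← intervalIntegral.integral_add_adjacent_intervals (hi 0 x) (hi x 1)]
  have h1 : ∫ u in (0 : ℝ)..x, Real.sign (u - x) * deriv A u = ∫ u in (0 : ℝ)..x, -deriv A u := by
    refine intervalIntegral.integral_congr_ae ?_
    have : ∀ᵐ u : ℝ, u ≠ x := by simp [ae_iff]
    filter_upwards [this] with u hu hm
    rw [uIoc_of_le hx.1] at hm
    rw [Real.sign_of_neg (sub_neg.2 (lt_of_le_of_ne hm.2 hu)), neg_one_mul]
  have h2 : ∫ u in x..1, Real.sign (u - x) * deriv A u = ∫ u in x..1, deriv A u := by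
    refine intervalIntegral.integral_congr_ae (.of_forall fun u hm => ?_)
    rw [uIoc_of_le hx.2] at hm
    rw [Real.sign_of_pos (sub_pos.2 hm.1), one_mul]
  rw [h1, h2, intervalIntegral.integral_neg, hA.integral_deriv, hA.integral_deriv, hA.map_zero,
    hA.map_one]
  ring

end IsPotential

/-- The product of the derivatives of two potentials, as a function on the plane. -/
noncomputable def perturbation (A B : ℝ → ℝ) (z : ℝ × ℝ) : ℝ := deriv A z.1 * deriv B z.2

variable {A B C D : ℝ → ℝ}

lemma contDiff_perturbation (hA : IsPotential A) (hB : IsPotential B) :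
    ContDiff ℝ 2 (perturbation A B) :=
  (hA.contDiff_deriv.comp contDiff_fst).mul (hB.contDiff_deriv.comp contDiff_snd)

lemma integrable_perturbation (hA : IsPotential A) (hB : IsPotential B) :
    Integrable (perturbation A B) squareMeasure :=
  integrable_of_continuousOn (contDiff_perturbation hA hB).continuous.continuousOn

lemma kendallForm_perturbation (hA : IsPotential A) (hB : IsPotential B) {G : ℝ × ℝ → ℝ}
    (hG : Integrable G squareMeasure) :
    kendallForm (perturbation A B) G = 4 * ∫ z, A z.1 * B z.2 * G z ∂squareMeasure := by
  rw [kendallForm, integral_prod_symm _ (integrable_kendall (integrable_perturbation hA hB) hG),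
    ← integral_const_mul]
  refine integral_congr_ae ?_
  filter_upwards [ae_mem_unitSquare] with z hz
  calc ∫ x, concordance (x, z) * (perturbation A B x * G z) ∂squareMeasure
      = ∫ x, (Real.sign (x.1 - z.1) * deriv A x.1) * (Real.sign (x.2 - z.2) * deriv B x.2) * G z
          ∂squareMeasure := by
        refine integral_congr_ae (.of_forall fun x => ?_)
        simp only [concordance, perturbation]
        ring
    _ = 4 * (A z.1 * B z.2 * G z) := by
        rw [integral_mul_const, integral_prod_mul (fun u => Real.sign (u - z.1) * deriv A u)
          (fun v => Real.sign (v - z.2) * deriv B v), hA.integral_sign_mul_deriv hz.1,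
          hB.integral_sign_mul_deriv hz.2]
        ring

lemma kendallForm_perturbation_self (hA : IsPotential A) (hB : IsPotential B) :
    kendallForm (perturbation A B) (perturbation A B) = 0 := by
  rw [kendallForm_perturbation hA hB (integrable_perturbation hA hB)]
  have h0 : ∫ u, A u * deriv A u ∂intervalMeasure = 0 := by
    rw [← integral_zero_one]
    have := intervalIntegral.integral_eq_sub_of_hasDerivAt (a := 0) (b := 1)
      (f := fun x => A x * A x / 2) (f' := fun u => A u * deriv A u)
      (fun x _ => (((hA.hasDerivAt x).mul (hA.hasDerivAt x)).div_const 2).congr_deriv (by ring))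
      ((hA.contDiff.continuous.mul hA.contDiff_deriv.continuous).intervalIntegrable _ _)
    rw [this, hA.map_zero, hA.map_one]
    ring
  have : ∫ z, A z.1 * B z.2 * perturbation A B z ∂squareMeasure
      = ∫ z, (A z.1 * deriv A z.1) * (B z.2 * deriv B z.2) ∂squareMeasure := by
    refine integral_congr_ae (.of_forall fun x => ?_)
    simp only [perturbation]
    ring
  rw [this, integral_prod_mul (fun u => A u * deriv A u) (fun v => B v * deriv B v), h0]
  simp

lemma integral_perturbation (hA : IsPotential A) :
    ∫ z, perturbation A B z ∂squareMeasure = 0 := by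
  simp only [perturbation]
  rw [integral_prod_mul (deriv A) (deriv B), ← integral_zero_one, hA.integral_deriv, hA.map_zero,
    hA.map_one]
  simp

lemma mul_log_le {p q : ℝ} (hp : 0 < p) (hq : 0 < q) :
    q * Real.log q ≤ p * Real.log p + (q - p) * Real.log p + (q - p) + (q - p) ^ 2 / p := by
  have h := mul_le_mul_of_nonneg_left (Real.log_le_sub_one_of_pos (div_pos hq hp)) hq.le
  rw [Real.log_div hq.ne' hp.ne'] at h
  have e : q * (q / p - 1) = (q - p) + (q - p) ^ 2 / p := by field_simp; ring
  nlinarith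

end MICK

namespace IsCopulaDensity

open MeasureTheory Set Filter Topology MICK

variable {p : ℝ → ℝ → ℝ}

lemma pos_uncurry (hp : IsCopulaDensity p) {z : ℝ × ℝ} (hz : z ∈ unitSquare) :
    0 < Function.uncurry p z := hp.pos z.1 hz.1 z.2 hz.2

lemma continuousOn (hp : IsCopulaDensity p) : ContinuousOn (Function.uncurry p) unitSquare :=
  hp.smooth.continuousOn

lemma integrable (hp : IsCopulaDensity p) : Integrable (Function.uncurry p) squareMeasure :=
  integrable_of_continuousOn hp.continuousOn

lemma continuousOn_log (hp : IsCopulaDensity p) :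
    ContinuousOn (fun z => Real.log (Function.uncurry p z)) unitSquare :=
  hp.continuousOn.log fun _ hz => (hp.pos_uncurry hz).ne'

lemma shannonInfo_eq (hp : IsCopulaDensity p) :
    shannonInfo p =
      ∫ z, Function.uncurry p z * Real.log (Function.uncurry p z) ∂squareMeasure :=
  integral_integral_zero_one
    (integrable_of_continuousOn (hp.continuousOn.mul hp.continuousOn_log))

lemma shannonInfo_add_le (hp : IsCopulaDensity p) {χ : ℝ × ℝ → ℝ} (hχ : Continuous χ)
    (hχ0 : ∫ z, χ z ∂squareMeasure = 0) {s : ℝ} {q : ℝ → ℝ → ℝ} (hq : IsCopulaDensity q)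
    (hqχ : Function.uncurry q = Function.uncurry p + s • χ) :
    shannonInfo q ≤ shannonInfo p
      + s * ∫ z, χ z * Real.log (Function.uncurry p z) ∂squareMeasure
      + s ^ 2 * ∫ z, χ z ^ 2 / Function.uncurry p z ∂squareMeasure := by
  have i1 : Integrable (fun z => Function.uncurry p z * Real.log (Function.uncurry p z))
      squareMeasure := integrable_of_continuousOn (hp.continuousOn.mul hp.continuousOn_log)
  have i2 : Integrable (fun z => s * (χ z * Real.log (Function.uncurry p z))) squareMeasure :=
    (integrable_of_continuousOn (hχ.continuousOn.mul hp.continuousOn_log)).const_mul s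
  have i3 : Integrable (fun z => s * χ z) squareMeasure :=
    (integrable_of_continuousOn hχ.continuousOn).const_mul s
  have i4 : Integrable (fun z => s ^ 2 * (χ z ^ 2 / Function.uncurry p z)) squareMeasure :=
    (integrable_of_continuousOn ((hχ.pow 2).continuousOn.div hp.continuousOn
      fun z hz => (hp.pos_uncurry hz).ne')).const_mul _
  have i12 : Integrable (fun z => Function.uncurry p z * Real.log (Function.uncurry p z)
      + s * (χ z * Real.log (Function.uncurry p z))) squareMeasure := i1.add i2
  have i123 : Integrable (fun z => Function.uncurry p z * Real.log (Function.uncurry p z)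
      + s * (χ z * Real.log (Function.uncurry p z)) + s * χ z) squareMeasure := i12.add i3
  have key : ∫ z, Function.uncurry q z * Real.log (Function.uncurry q z) ∂squareMeasure ≤
      ∫ z, (Function.uncurry p z * Real.log (Function.uncurry p z)
        + s * (χ z * Real.log (Function.uncurry p z)) + s * χ z
        + s ^ 2 * (χ z ^ 2 / Function.uncurry p z)) ∂squareMeasure := by
    refine integral_mono_ae
      (integrable_of_continuousOn (hq.continuousOn.mul hq.continuousOn_log))
      (i123.add i4) ?_
    filter_upwards [ae_mem_unitSquare] with z hz
    have h := mul_log_le (hp.pos_uncurry hz) (hq.pos_uncurry hz)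
    have e : Function.uncurry q z - Function.uncurry p z = s * χ z := by
      simp [hqχ]
    rw [e, mul_pow, mul_assoc s, mul_div_assoc] at h
    exact h
  rw [integral_add i123 i4, integral_add i12 i3, integral_add i1 i2,
    integral_const_mul, integral_const_mul, integral_const_mul, hχ0, mul_zero, add_zero] at key
  rwa [hq.shannonInfo_eq, hp.shannonInfo_eq]

/-- Adding a small perturbation with vanishing marginals yields a copula density. -/
lemma add_perturbation (hp : IsCopulaDensity p) {A B C D : ℝ → ℝ} (hA : IsPotential A)
    (hB : IsPotential B) (hC : IsPotential C) (hD : IsPotential D) (s t : ℝ)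
    (hpos : ∀ z ∈ unitSquare,
      0 < Function.uncurry p z + s * perturbation A B z + t * perturbation C D z) :
    IsCopulaDensity fun u v => p u v + s * perturbation A B (u, v)
      + t * perturbation C D (u, v) where
  smooth := (hp.smooth.add (contDiff_const.mul (contDiff_perturbation hA hB)).contDiffOn).add
    (contDiff_const.mul (contDiff_perturbation hC hD)).contDiffOn
  pos u hu v hv := hpos (u, v) ⟨hu, hv⟩
  margU v hv := by
    have ip : IntervalIntegrable (fun u => p u v) volume 0 1 :=
      ContinuousOn.intervalIntegrable_of_Icc zero_le_one
        (hp.continuousOn.comp (f := fun u => (u, v)) (by fun_prop) fun u hu => ⟨hu, hv⟩)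
    have i1 : IntervalIntegrable (fun u => s * perturbation A B (u, v)) volume 0 1 :=
      (continuous_const.mul ((contDiff_perturbation hA hB).continuous.comp
        (by fun_prop))).intervalIntegrable _ _
    have i2 : IntervalIntegrable (fun u => t * perturbation C D (u, v)) volume 0 1 :=
      (continuous_const.mul ((contDiff_perturbation hC hD).continuous.comp
        (by fun_prop))).intervalIntegrable _ _
    rw [intervalIntegral.integral_add (ip.add i1) i2, intervalIntegral.integral_add ip i1,
      hp.margU v hv]
    simp [perturbation, hA.integral_deriv, hC.integral_deriv, hA.map_zero, hA.map_one,
      hC.map_zero, hC.map_one]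
  margV u hu := by
    have ip : IntervalIntegrable (fun v => p u v) volume 0 1 :=
      ContinuousOn.intervalIntegrable_of_Icc zero_le_one
        (hp.continuousOn.comp (f := fun v => (u, v)) (by fun_prop) fun v hv => ⟨hu, hv⟩)
    have i1 : IntervalIntegrable (fun v => s * perturbation A B (u, v)) volume 0 1 :=
      (continuous_const.mul ((contDiff_perturbation hA hB).continuous.comp
        (by fun_prop))).intervalIntegrable _ _
    have i2 : IntervalIntegrable (fun v => t * perturbation C D (u, v)) volume 0 1 :=
      (continuous_const.mul ((contDiff_perturbation hC hD).continuous.comp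
        (by fun_prop))).intervalIntegrable _ _
    rw [intervalIntegral.integral_add (ip.add i1) i2, intervalIntegral.integral_add ip i1,
      hp.margV u hu]
    simp [perturbation, hB.integral_deriv, hD.integral_deriv, hB.map_zero, hB.map_one,
      hD.map_zero, hD.map_one]

lemma eq_zero_of_eventually_mul_nonneg {g : ℝ → ℝ} (hg : ContinuousAt g 0)
    (h : ∀ᶠ s in 𝓝 (0 : ℝ), 0 ≤ s * g s) : g 0 = 0 := by
  apply le_antisymm
  · refine le_of_tendsto (hg.tendsto.mono_left (nhdsWithin_le_nhds (s := Iio 0))) ?_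
    filter_upwards [nhdsWithin_le_nhds h, self_mem_nhdsWithin] with s hs hs0
    exact nonpos_of_mul_nonneg_right hs hs0
  · refine ge_of_tendsto (hg.tendsto.mono_left (nhdsWithin_le_nhds (s := Ioi 0))) ?_
    filter_upwards [nhdsWithin_le_nhds h, self_mem_nhdsWithin] with s hs hs0
    exact nonneg_of_mul_nonneg_right hs hs0

lemma kendallTau_add_perturbation (hp : IsCopulaDensity p) {A B C D : ℝ → ℝ}
    (hA : IsPotential A) (hB : IsPotential B) (hC : IsPotential C) (hD : IsPotential D)
    (s t : ℝ) :
    kendallTau (fun u v => p u v + s * perturbation A B (u, v) + t * perturbation C D (u, v)) =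
      kendallTau p + 2 * s * kendallForm (perturbation A B) (Function.uncurry p)
        + 2 * t * kendallForm (perturbation C D) (Function.uncurry p)
        + 2 * s * t * kendallForm (perturbation A B) (perturbation C D) := by
  have iφ := (integrable_perturbation hA hB).smul s
  have iψ := (integrable_perturbation hC hD).smul t
  have e : Function.uncurry (fun u v => p u v + s * perturbation A B (u, v)
      + t * perturbation C D (u, v)) =
      Function.uncurry p + s • perturbation A B + t • perturbation C D := rfl
  rw [kendallTau_eq (e ▸ (hp.integrable.add iφ).add iψ), e,
    kendallForm_add_self (hp.integrable.add iφ) iψ, kendallForm_add_self hp.integrable iφ,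
    kendallForm_comm (t • _) (_ + _), kendallForm_add_left hp.integrable iφ iψ,
    kendallForm_comm _ (t • _), kendallTau_eq hp.integrable]
  simp only [kendallForm_smul_left]
  rw [kendallForm_comm _ (s • _), kendallForm_comm _ (t • _), kendallForm_comm _ (t • _)]
  simp only [kendallForm_smul_left]
  rw [kendallForm_perturbation_self hA hB, kendallForm_perturbation_self hC hD,
    kendallForm_comm (perturbation C D) (perturbation A B)]
  ring

/-- First-order optimality of a minimizer, tested against product perturbations. -/
lemma stationarity (hp : IsCopulaDensity p)
    (hmin : ∀ q, IsCopulaDensity q → kendallTau q = kendallTau p → shannonInfo p ≤ shannonInfo q)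
    {A B C D : ℝ → ℝ} (hA : IsPotential A) (hB : IsPotential B) (hC : IsPotential C)
    (hD : IsPotential D) (hCD : kendallForm (perturbation C D) (Function.uncurry p) ≠ 0) :
    (∫ z, perturbation A B z * Real.log (Function.uncurry p z) ∂squareMeasure) =
      kendallForm (perturbation A B) (Function.uncurry p)
        / kendallForm (perturbation C D) (Function.uncurry p)
      * ∫ z, perturbation C D z * Real.log (Function.uncurry p z) ∂squareMeasure := by
  set P := Function.uncurry p with hP
  set φ := perturbation A B with hφ
  set ψ := perturbation C D with hψ
  set lφ := kendallForm φ P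
  set lψ := kendallForm ψ P
  set X := kendallForm φ ψ
  have cφ : Continuous φ := (contDiff_perturbation hA hB).continuous
  have cψ : Continuous ψ := (contDiff_perturbation hC hD).continuous
  let r : ℝ → ℝ := fun s => -lφ / (lψ + s * X)
  have hr : ContinuousAt r 0 := by
    refine ContinuousAt.div (by fun_prop) (by fun_prop) (by simpa using hCD)
  let g : ℝ → ℝ := fun s => (∫ z, φ z * Real.log (P z) ∂squareMeasure)
    + r s * (∫ z, ψ z * Real.log (P z) ∂squareMeasure)
    + s * ((∫ z, φ z ^ 2 / P z ∂squareMeasure) + 2 * r s * (∫ z, φ z * ψ z / P z ∂squareMeasure)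
      + r s ^ 2 * ∫ z, ψ z ^ 2 / P z ∂squareMeasure)
  have hg : ContinuousAt g 0 := by fun_prop
  have hne : ∀ᶠ s in 𝓝 (0 : ℝ), lψ + s * X ≠ 0 := by
    have : ContinuousAt (fun s : ℝ => lψ + s * X) 0 := by fun_prop
    exact this.eventually_ne (by simpa using hCD)
  have hpos : ∀ᶠ s in 𝓝 (0 : ℝ), ∀ z ∈ unitSquare, 0 < P z + s * φ z + s * r s * ψ z := by
    obtain ⟨z₀, hz₀, hmin₀⟩ := isCompact_unitSquare.exists_isMinOn
      ⟨(0, 0), by simp [unitSquare]⟩ hp.continuousOn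
    obtain ⟨a, ha⟩ := isCompact_unitSquare.exists_bound_of_continuousOn cφ.continuousOn
    obtain ⟨b, hb⟩ := isCompact_unitSquare.exists_bound_of_continuousOn cψ.continuousOn
    have hc : ContinuousAt (fun s : ℝ => |s| * a + |s * r s| * b) 0 := by fun_prop
    have : ∀ᶠ s in 𝓝 (0 : ℝ), |s| * a + |s * r s| * b < P z₀ :=
      hc.eventually_lt_const (by simpa using hp.pos_uncurry hz₀)
    filter_upwards [this] with s hs z hz
    have h1 : P z₀ ≤ P z := hmin₀ hz
    have h2 : |s * φ z| ≤ |s| * a := by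
      rw [abs_mul]; exact mul_le_mul_of_nonneg_left (ha z hz) (abs_nonneg _)
    have h3 : |s * r s * ψ z| ≤ |s * r s| * b := by
      rw [abs_mul]; exact mul_le_mul_of_nonneg_left (hb z hz) (abs_nonneg _)
    have := neg_abs_le (s * φ z)
    have := neg_abs_le (s * r s * ψ z)
    linarith
  have hsg : ∀ᶠ s in 𝓝 (0 : ℝ), 0 ≤ s * g s := by
    filter_upwards [hne, hpos] with s hs hspos
    have hq := hp.add_perturbation hA hB hC hD s (s * r s) hspos
    have hτ := hp.kendallTau_add_perturbation hA hB hC hD s (s * r s)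
    have hle := hmin _ hq (by
      rw [hτ]
      change kendallTau p + 2 * s * lφ + 2 * (s * r s) * lψ + 2 * s * (s * r s) * X = kendallTau p
      have : r s * (lψ + s * X) = -lφ := div_mul_cancel₀ _ hs
      linear_combination 2 * s * this)
    have hup := hp.shannonInfo_add_le (χ := φ + r s • ψ) (s := s) (cφ.add (cψ.const_smul _))
      (by
        simp only [Pi.add_apply, Pi.smul_apply, smul_eq_mul]
        rw [integral_add (integrable_perturbation hA hB)
          ((integrable_perturbation hC hD).const_mul _), integral_const_mul,
          integral_perturbation hA, integral_perturbation hC]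
        simp) hq (by
        ext z
        simp only [Function.uncurry, Pi.add_apply, Pi.smul_apply, smul_eq_mul, ← hφ, ← hψ]
        ring)
    have inv : ∀ {F : ℝ × ℝ → ℝ}, Continuous F → Integrable (fun z => F z / P z) squareMeasure :=
      fun hF => integrable_of_continuousOn
        (hF.continuousOn.div hp.continuousOn fun z hz => (hp.pos_uncurry hz).ne')
    have e1 : ∫ z, (φ + r s • ψ) z * Real.log (P z) ∂squareMeasure
        = (∫ z, φ z * Real.log (P z) ∂squareMeasure)
          + r s * ∫ z, ψ z * Real.log (P z) ∂squareMeasure := by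
      have i1 : Integrable (fun z => φ z * Real.log (P z)) squareMeasure :=
        integrable_of_continuousOn (cφ.continuousOn.mul hp.continuousOn_log)
      have i2 : Integrable (fun z => r s * (ψ z * Real.log (P z))) squareMeasure :=
        (integrable_of_continuousOn (cψ.continuousOn.mul hp.continuousOn_log)).const_mul _
      rw [← integral_const_mul, ← integral_add i1 i2]
      refine integral_congr_ae (.of_forall fun z => ?_)
      simp only [Pi.add_apply, Pi.smul_apply, smul_eq_mul]
      ring
    have e2 : ∫ z, (φ + r s • ψ) z ^ 2 / P z ∂squareMeasure
        = (∫ z, φ z ^ 2 / P z ∂squareMeasure)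
          + 2 * r s * (∫ z, φ z * ψ z / P z ∂squareMeasure)
          + r s ^ 2 * ∫ z, ψ z ^ 2 / P z ∂squareMeasure := by
      have i1 : Integrable (fun z => φ z ^ 2 / P z) squareMeasure := inv (cφ.pow 2)
      have i2 : Integrable (fun z => 2 * r s * (φ z * ψ z / P z)) squareMeasure :=
        (inv (cφ.mul cψ)).const_mul _
      have i3 : Integrable (fun z => r s ^ 2 * (ψ z ^ 2 / P z)) squareMeasure :=
        (inv (cψ.pow 2)).const_mul _
      have i12 : Integrable (fun z => φ z ^ 2 / P z + 2 * r s * (φ z * ψ z / P z)) squareMeasure :=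
        i1.add i2
      rw [← integral_const_mul, ← integral_const_mul, ← integral_add i1 i2,
        ← integral_add i12 i3]
      refine integral_congr_ae (.of_forall fun z => ?_)
      simp only [Pi.add_apply, Pi.smul_apply, smul_eq_mul]
      ring
    rw [e1, e2] at hup
    have := hle.trans hup
    simp only [g]
    linarith
  have h0 := eq_zero_of_eventually_mul_nonneg hg hsg
  simp only [g, r, zero_mul, add_zero] at h0
  rw [neg_div, neg_mul] at h0
  linarith

end IsCopulaDensity

namespace MICK

open MeasureTheory Set Filter Topology

/-- The open unit square. -/
abbrev openUnitSquare : Set (ℝ × ℝ) := Ioo 0 1 ×ˢ Ioo 0 1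

lemma isOpen_openUnitSquare : IsOpen openUnitSquare := isOpen_Ioo.prod isOpen_Ioo

/-- A smooth function supported in `(α, β)`, a subinterval compactly contained in `(0, 1)`. -/
structure IsTestOn (A : ℝ → ℝ) (α β : ℝ) : Prop where
  contDiff : ContDiff ℝ 3 A
  pos : 0 < α
  le : α ≤ β
  lt_one : β < 1
  eq_zero : ∀ x ∉ Ioo α β, A x = 0

namespace IsTestOn

variable {A : ℝ → ℝ} {α β : ℝ}

lemma isPotential (hA : IsTestOn A α β) : IsPotential A where
  contDiff := hA.contDiff
  map_zero := hA.eq_zero 0 fun h => (hA.pos.trans h.1).false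
  map_one := hA.eq_zero 1 fun h => (hA.lt_one.trans h.2).false

lemma left_eq_zero (hA : IsTestOn A α β) : A α = 0 := hA.eq_zero α fun h => h.1.false

lemma right_eq_zero (hA : IsTestOn A α β) : A β = 0 := hA.eq_zero β fun h => h.2.false

lemma deriv_eq_zero (hA : IsTestOn A α β) {x : ℝ} (hx : x ∉ Icc α β) : deriv A x = 0 := by
  have : A =ᶠ[𝓝 x] fun _ => 0 := by
    filter_upwards [isClosed_Icc.isOpen_compl.mem_nhds hx] with y hy
    exact hA.eq_zero y fun h => hy (Ioo_subset_Icc_self h)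
  rw [this.deriv_eq, deriv_const]

lemma Icc_subset (hA : IsTestOn A α β) : Icc α β ⊆ Ioo 0 1 := fun _ hx =>
  ⟨hA.pos.trans_le hx.1, hx.2.trans_lt hA.lt_one⟩

end IsTestOn

section Box

variable {α β γ δ : ℝ} {G : ℝ × ℝ → ℝ}

lemma integral_eq_setIntegral_box (h₁ : Icc α β ⊆ Ioo 0 1) (h₂ : Icc γ δ ⊆ Ioo 0 1)
    (hG : ∀ z ∉ Icc α β ×ˢ Icc γ δ, G z = 0) :
    ∫ z, G z ∂squareMeasure = ∫ z in Icc α β ×ˢ Icc γ δ, G z := by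
  rw [squareMeasure_eq]
  exact setIntegral_eq_of_subset_of_forall_sdiff_eq_zero
    (measurableSet_Ioc.prod measurableSet_Ioc)
    (prod_mono (h₁.trans Ioo_subset_Ioc_self) (h₂.trans Ioo_subset_Ioc_self))
    fun z hz => hG z hz.2

lemma integrable_of_box (hc : ContinuousOn G (Icc α β ×ˢ Icc γ δ))
    (hG : ∀ z ∉ Icc α β ×ˢ Icc γ δ, G z = 0) : Integrable G squareMeasure := by
  have h := hc.integrableOn_compact (μ := volume) (isCompact_Icc.prod isCompact_Icc)
  rw [squareMeasure_eq]
  exact ((integrableOn_iff_integrable_of_support_subset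
    fun z hz => by_contra fun h => hz (hG z h)).1 h).integrableOn

lemma setIntegral_box (h₁ : α ≤ β) (h₂ : γ ≤ δ) (hc : ContinuousOn G (Icc α β ×ˢ Icc γ δ)) :
    ∫ z in Icc α β ×ˢ Icc γ δ, G z = ∫ u in α..β, ∫ v in γ..δ, G (u, v) := by
  have h := hc.integrableOn_compact (μ := volume) (isCompact_Icc.prod isCompact_Icc)
  rw [Measure.volume_eq_prod, setIntegral_prod _ h]
  simp only [intervalIntegral.integral_of_le h₁, intervalIntegral.integral_of_le h₂,
    integral_Icc_eq_integral_Ioc]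

lemma setIntegral_box_symm (h₁ : α ≤ β) (h₂ : γ ≤ δ)
    (hc : ContinuousOn G (Icc α β ×ˢ Icc γ δ)) :
    ∫ z in Icc α β ×ˢ Icc γ δ, G z = ∫ v in γ..δ, ∫ u in α..β, G (u, v) := by
  have h := hc.integrableOn_compact (μ := volume) (isCompact_Icc.prod isCompact_Icc)
  rw [IntegrableOn, Measure.volume_eq_prod, ← Measure.prod_restrict] at h
  rw [Measure.volume_eq_prod, ← Measure.prod_restrict, integral_prod_symm _ h]
  simp only [intervalIntegral.integral_of_le h₁, intervalIntegral.integral_of_le h₂,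
    integral_Icc_eq_integral_Ioc]

end Box

section MixedDerivative

variable (F : ℝ × ℝ → ℝ)

/-- The partial derivative in the second variable. -/
noncomputable def partialSnd (z : ℝ × ℝ) : ℝ := fderiv ℝ F z (0, 1)

/-- The mixed partial derivative `∂²/∂u∂v`. -/
noncomputable def mixedPartial (z : ℝ × ℝ) : ℝ := fderiv ℝ (partialSnd F) z (1, 0)

variable {F} {Ω : Set (ℝ × ℝ)}

lemma contDiffOn_partialSnd (hΩ : IsOpen Ω) (hF : ContDiffOn ℝ 2 F Ω) :
    ContDiffOn ℝ 1 (partialSnd F) Ω :=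
  (hF.fderiv_of_isOpen hΩ (by norm_num)).clm_apply contDiffOn_const

lemma continuousOn_mixedPartial (hΩ : IsOpen Ω) (hF : ContDiffOn ℝ 2 F Ω) :
    ContinuousOn (mixedPartial F) Ω :=
  ((contDiffOn_partialSnd hΩ hF).continuousOn_fderiv_of_isOpen hΩ (by norm_num)).clm_apply
    continuousOn_const

lemma hasDerivAt_partialSnd (hΩ : IsOpen Ω) (hF : ContDiffOn ℝ 2 F Ω) {u v : ℝ}
    (h : (u, v) ∈ Ω) : HasDerivAt (fun v' => F (u, v')) (partialSnd F (u, v)) v :=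
  ((hF.contDiffAt (hΩ.mem_nhds h)).differentiableAt (by norm_num)).hasFDerivAt.comp_hasDerivAt v
    ((hasDerivAt_const v u).prodMk (hasDerivAt_id' v))

lemma hasDerivAt_mixedPartial (hΩ : IsOpen Ω) (hF : ContDiffOn ℝ 2 F Ω) {u v : ℝ}
    (h : (u, v) ∈ Ω) :
    HasDerivAt (fun u' => partialSnd F (u', v)) (mixedPartial F (u, v)) u := by
  have hd := (((contDiffOn_partialSnd hΩ hF).contDiffAt (hΩ.mem_nhds h)).differentiableAt
    (by norm_num)).hasFDerivAt
  exact hd.comp_hasDerivAt u ((hasDerivAt_id' u).prodMk (hasDerivAt_const u v))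

lemma integral_perturbation_mul {A B : ℝ → ℝ} {α β γ δ : ℝ} (hA : IsTestOn A α β)
    (hB : IsTestOn B γ δ) (hF : ContDiffOn ℝ 2 F openUnitSquare) :
    ∫ z, perturbation A B z * F z ∂squareMeasure =
      ∫ z, A z.1 * B z.2 * mixedPartial F z ∂squareMeasure := by
  have hΩ := isOpen_openUnitSquare
  have hsub : Icc α β ×ˢ Icc γ δ ⊆ openUnitSquare := prod_mono hA.Icc_subset hB.Icc_subset
  have cA := hA.contDiff.continuous
  have cB := hB.contDiff.continuous
  have cA' := hA.isPotential.contDiff_deriv.continuous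
  have cB' := hB.isPotential.contDiff_deriv.continuous
  have cF := hF.continuousOn.mono hsub
  have cFv := (contDiffOn_partialSnd hΩ hF).continuousOn.mono hsub
  have cFuv := (continuousOn_mixedPartial hΩ hF).mono hsub
  have sliceU {G : ℝ × ℝ → ℝ} (hG : ContinuousOn G (Icc α β ×ˢ Icc γ δ)) {v : ℝ}
      (hv : v ∈ Icc γ δ) : IntervalIntegrable (fun u => G (u, v)) volume α β :=
    ContinuousOn.intervalIntegrable_of_Icc hA.le
      (hG.comp (f := fun u => (u, v)) (by fun_prop) fun u hu => ⟨hu, hv⟩)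
  have sliceV {G : ℝ × ℝ → ℝ} (hG : ContinuousOn G (Icc α β ×ˢ Icc γ δ)) {u : ℝ}
      (hu : u ∈ Icc α β) : IntervalIntegrable (fun v => G (u, v)) volume γ δ :=
    ContinuousOn.intervalIntegrable_of_Icc hB.le
      (hG.comp (f := fun v => (u, v)) (by fun_prop) fun v hv => ⟨hu, hv⟩)
  rw [integral_eq_setIntegral_box hA.Icc_subset hB.Icc_subset fun z hz => ?_,
    integral_eq_setIntegral_box hA.Icc_subset hB.Icc_subset fun z hz => ?_,
    setIntegral_box hA.le hB.le, setIntegral_box_symm hA.le hB.le]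
  · have e1 : ∀ u ∈ uIcc α β, ∫ v in γ..δ, perturbation A B (u, v) * F (u, v) =
        ∫ v in γ..δ, -(deriv A u * B v * partialSnd F (u, v)) := by
      intro u hu
      rw [uIcc_of_le hA.le] at hu
      have := intervalIntegral.integral_mul_deriv_eq_deriv_mul (a := γ) (b := δ)
        (u := fun v => F (u, v)) (v := B) (u' := fun v => partialSnd F (u, v)) (v' := deriv B)
        (fun v hv => hasDerivAt_partialSnd hΩ hF (hsub ⟨hu, by rwa [uIcc_of_le hB.le] at hv⟩))
        (fun v _ => hB.isPotential.hasDerivAt v) (sliceV cFv hu) (cB'.intervalIntegrable _ _)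
      rw [hB.left_eq_zero, hB.right_eq_zero, mul_zero, mul_zero, sub_zero, zero_sub] at this
      calc ∫ v in γ..δ, perturbation A B (u, v) * F (u, v)
          = deriv A u * ∫ v in γ..δ, F (u, v) * deriv B v := by
            rw [← intervalIntegral.integral_const_mul]
            refine intervalIntegral.integral_congr fun v _ => ?_
            simp only [perturbation]
            ring
        _ = ∫ v in γ..δ, -(deriv A u * B v * partialSnd F (u, v)) := by
            rw [this, intervalIntegral.integral_neg, mul_neg,
              ← intervalIntegral.integral_const_mul]
            refine congrArg Neg.neg (intervalIntegral.integral_congr fun v _ => ?_)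
            ring
    have e2 : ∀ v ∈ uIcc γ δ, ∫ u in α..β, -(deriv A u * B v * partialSnd F (u, v)) =
        ∫ u in α..β, A u * B v * mixedPartial F (u, v) := by
      intro v hv
      rw [uIcc_of_le hB.le] at hv
      have := intervalIntegral.integral_mul_deriv_eq_deriv_mul (a := α) (b := β)
        (u := fun u => partialSnd F (u, v)) (v := A) (u' := fun u => mixedPartial F (u, v))
        (v' := deriv A)
        (fun u hu => hasDerivAt_mixedPartial hΩ hF (hsub ⟨by rwa [uIcc_of_le hA.le] at hu, hv⟩))
        (fun u _ => hA.isPotential.hasDerivAt u) (sliceU cFuv hv) (cA'.intervalIntegrable _ _)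
      rw [hA.left_eq_zero, hA.right_eq_zero, mul_zero, mul_zero, sub_zero, zero_sub] at this
      calc ∫ u in α..β, -(deriv A u * B v * partialSnd F (u, v))
          = -B v * ∫ u in α..β, partialSnd F (u, v) * deriv A u := by
            rw [← intervalIntegral.integral_const_mul]
            refine intervalIntegral.integral_congr fun u _ => ?_
            ring
        _ = ∫ u in α..β, A u * B v * mixedPartial F (u, v) := by
            rw [this, neg_mul_neg, ← intervalIntegral.integral_const_mul]
            refine intervalIntegral.integral_congr fun u _ => ?_
            ring
    have cG : ContinuousOn (fun z : ℝ × ℝ => -(deriv A z.1 * B z.2 * partialSnd F z))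
        (Icc α β ×ˢ Icc γ δ) :=
      (((cA'.comp continuous_fst).mul (cB.comp continuous_snd)).continuousOn.mul cFv).neg
    rw [intervalIntegral.integral_congr e1, ← intervalIntegral.integral_congr e2,
      ← setIntegral_box_symm hA.le hB.le cG, setIntegral_box hA.le hB.le cG]
  · exact ((cA.comp continuous_fst).mul (cB.comp continuous_snd)).continuousOn.mul cFuv
  · exact (contDiff_perturbation hA.isPotential hB.isPotential).continuous.continuousOn.mul cF
  · rw [mem_prod, not_and_or] at hz
    rcases hz with h | h
    · rw [hA.eq_zero _ fun h' => h (Ioo_subset_Icc_self h')]; ring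
    · rw [hB.eq_zero _ fun h' => h (Ioo_subset_Icc_self h')]; ring
  · rw [mem_prod, not_and_or] at hz
    rcases hz with h | h
    · rw [perturbation, hA.deriv_eq_zero h]; ring
    · rw [perturbation, hB.deriv_eq_zero h]; ring

end MixedDerivative

lemma test_mul_eq_zero {A B : ℝ → ℝ} {α β γ δ : ℝ} (hA : IsTestOn A α β) (hB : IsTestOn B γ δ)
    (G : ℝ × ℝ → ℝ) : ∀ z ∉ Icc α β ×ˢ Icc γ δ, A z.1 * B z.2 * G z = 0 := by
  intro z hz
  rw [mem_prod, not_and_or] at hz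
  rcases hz with h | h
  · rw [hA.eq_zero _ fun h' => h (Ioo_subset_Icc_self h')]; ring
  · rw [hB.eq_zero _ fun h' => h (Ioo_subset_Icc_self h')]; ring

lemma integrable_test_mul {A B : ℝ → ℝ} {α β γ δ : ℝ} (hA : IsTestOn A α β)
    (hB : IsTestOn B γ δ) {G : ℝ × ℝ → ℝ} (hG : ContinuousOn G openUnitSquare) :
    Integrable (fun z => A z.1 * B z.2 * G z) squareMeasure :=
  integrable_of_box
    ((((hA.contDiff.continuous.comp continuous_fst).mul
      (hB.contDiff.continuous.comp continuous_snd)).continuousOn).mul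
      (hG.mono (prod_mono hA.Icc_subset hB.Icc_subset))) (test_mul_eq_zero hA hB G)

lemma exists_test (c r : ℝ) (hr : 0 < r) (h0 : 0 < c - r) (h1 : c + r < 1) :
    ∃ A : ℝ → ℝ, IsTestOn A (c - r) (c + r) ∧ (∀ x, 0 ≤ A x) ∧
      0 < ∫ x, A x ∂intervalMeasure := by
  let f : ContDiffBump c := ⟨r / 2, r, by linarith, by linarith⟩
  have hf : ∀ x ∉ Ioo (c - r) (c + r), f x = 0 := fun x hx => by
    rw [← Real.ball_eq_Ioo] at hx
    exact f.zero_of_le_dist (not_lt.1 hx)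
  refine ⟨f, ⟨f.contDiff, h0, by linarith, h1, hf⟩, fun x => f.nonneg, ?_⟩
  have hsupp : ∀ x ∉ Ioc (0 : ℝ) 1, f x = 0 := fun x hx => hf x fun h =>
    hx ⟨h0.trans h.1, (h.2.trans h1).le⟩
  rw [setIntegral_eq_integral_of_forall_compl_eq_zero hsupp]
  exact f.integral_pos

lemma exists_test_integral_pos {G : ℝ × ℝ → ℝ} (hG : ContinuousOn G openUnitSquare)
    {z : ℝ × ℝ} (hz : z ∈ openUnitSquare) (hpos : 0 < G z) :
    ∃ A B α β γ δ, IsTestOn A α β ∧ IsTestOn B γ δ ∧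
      0 < ∫ x, A x.1 * B x.2 * G x ∂squareMeasure := by
  have hev : ∀ᶠ x in 𝓝 z, x ∈ openUnitSquare ∧ G z / 2 < G x :=
    Filter.Eventually.and (isOpen_openUnitSquare.mem_nhds hz)
      ((hG.continuousAt (isOpen_openUnitSquare.mem_nhds hz)).eventually_const_lt
        (half_lt_self hpos))
  obtain ⟨r, hr, hball⟩ := Metric.nhds_basis_closedBall.eventually_iff.1 hev
  have hbox : Icc (z.1 - r) (z.1 + r) ×ˢ Icc (z.2 - r) (z.2 + r) = Metric.closedBall z r := by
    rw [← Real.closedBall_eq_Icc, ← Real.closedBall_eq_Icc, closedBall_prod_same]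
  rw [← hbox] at hball
  have hl := (hball (x := (z.1 - r, z.2 - r)) (by simp; constructor <;> linarith)).1
  have hu := (hball (x := (z.1 + r, z.2 + r)) (by simp; constructor <;> linarith)).1
  obtain ⟨A, hA, hA0, hAi⟩ := exists_test z.1 r hr hl.1.1 hu.1.2
  obtain ⟨B, hB, hB0, hBi⟩ := exists_test z.2 r hr hl.2.1 hu.2.2
  refine ⟨A, B, _, _, _, _, hA, hB, ?_⟩
  have hint : 0 < ∫ x : ℝ × ℝ, A x.1 * B x.2 * (G z / 2) ∂squareMeasure := by
    rw [integral_mul_const, integral_prod_mul A B]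
    positivity
  refine hint.trans_le (integral_mono (integrable_test_mul hA hB continuousOn_const)
    (integrable_test_mul hA hB hG) fun x => ?_)
  by_cases hx : x ∈ Icc (z.1 - r) (z.1 + r) ×ˢ Icc (z.2 - r) (z.2 + r)
  · exact mul_le_mul_of_nonneg_left (hball hx).2.le (mul_nonneg (hA0 _) (hB0 _))
  · exact (test_mul_eq_zero hA hB (fun _ => G z / 2) x hx).trans_le (test_mul_eq_zero hA hB G x hx).ge

lemma eq_zero_of_forall_test {G : ℝ × ℝ → ℝ} (hG : ContinuousOn G openUnitSquare)
    (h : ∀ A B α β γ δ, IsTestOn A α β → IsTestOn B γ δ →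
      ∫ x, A x.1 * B x.2 * G x ∂squareMeasure = 0) {z : ℝ × ℝ} (hz : z ∈ openUnitSquare) :
    G z = 0 := by
  rcases lt_trichotomy (G z) 0 with hneg | h0 | hpos
  · obtain ⟨A, B, α, β, γ, δ, hA, hB, hi⟩ :=
      exists_test_integral_pos hG.neg hz (neg_pos.2 hneg)
    simp only [Pi.neg_apply, mul_neg, integral_neg, h A B α β γ δ hA hB, neg_zero] at hi
    exact absurd hi (lt_irrefl 0)
  · exact h0
  · obtain ⟨A, B, α, β, γ, δ, hA, hB, hi⟩ := exists_test_integral_pos hG hz hpos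
    exact absurd (h A B α β γ δ hA hB) hi.ne'

end MICK

namespace IsCopulaDensity

open MeasureTheory Set Filter Topology MICK

variable {p : ℝ → ℝ → ℝ}

lemma openUnitSquare_subset : openUnitSquare ⊆ unitSquare :=
  prod_mono Ioo_subset_Icc_self Ioo_subset_Icc_self

lemma contDiffOn_log (hp : IsCopulaDensity p) :
    ContDiffOn ℝ 2 (fun z => Real.log (Function.uncurry p z)) openUnitSquare :=
  (hp.smooth.mono openUnitSquare_subset).log
    fun _ hz => (hp.pos_uncurry (openUnitSquare_subset hz)).ne'

/-- The stationarity equation: `∂²/∂u∂v log p` is a constant multiple of `p`. -/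
lemma exists_mixedPartial_log_eq (hp : IsCopulaDensity p)
    (hmin : ∀ q, IsCopulaDensity q → kendallTau q = kendallTau p →
      shannonInfo p ≤ shannonInfo q) :
    ∃ c, ∀ z ∈ openUnitSquare,
      mixedPartial (fun z => Real.log (Function.uncurry p z)) z = c * Function.uncurry p z := by
  have cp := hp.continuousOn.mono openUnitSquare_subset
  have cm := continuousOn_mixedPartial isOpen_openUnitSquare hp.contDiffOn_log
  have hz₀ : ((1 / 2, 1 / 2) : ℝ × ℝ) ∈ openUnitSquare := by norm_num [openUnitSquare]
  obtain ⟨C, D, _, _, _, _, hC, hD, hpos⟩ :=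
    exists_test_integral_pos cp hz₀ (hp.pos_uncurry (openUnitSquare_subset hz₀))
  have hne : kendallForm (perturbation C D) (Function.uncurry p) ≠ 0 := by
    rw [kendallForm_perturbation hC.isPotential hD.isPotential hp.integrable]
    positivity
  set l := kendallForm (perturbation C D) (Function.uncurry p)
  set m := ∫ z, perturbation C D z * Real.log (Function.uncurry p z) ∂squareMeasure
  refine ⟨4 / l * m, fun z hz => sub_eq_zero.1 ?_⟩
  refine eq_zero_of_forall_test
    (G := fun z => mixedPartial (fun z => Real.log (Function.uncurry p z)) z
      - 4 / l * m * Function.uncurry p z) (cm.sub (continuousOn_const.mul cp)) ?_ hz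
  intro A B _ _ _ _ hA hB
  have hst := hp.stationarity hmin hA.isPotential hB.isPotential hC.isPotential hD.isPotential hne
  rw [integral_perturbation_mul hA hB hp.contDiffOn_log,
    kendallForm_perturbation hA.isPotential hB.isPotential hp.integrable] at hst
  have i1 := integrable_test_mul hA hB cm
  have i2 := (integrable_test_mul hA hB cp).const_mul (4 / l * m)
  calc ∫ x, A x.1 * B x.2 * (mixedPartial (fun z => Real.log (Function.uncurry p z)) x
        - 4 / l * m * Function.uncurry p x) ∂squareMeasure
      = ∫ x, (A x.1 * B x.2 * mixedPartial (fun z => Real.log (Function.uncurry p z)) x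
        - 4 / l * m * (A x.1 * B x.2 * Function.uncurry p x)) ∂squareMeasure := by
        refine integral_congr_ae (.of_forall fun x => ?_)
        ring
    _ = 0 := by
        rw [integral_sub i1 i2, integral_const_mul, hst]
        ring

/-- The partial distribution function `∫₀ᵘ p(x, v) dx`. -/
noncomputable def partialCDF (p : ℝ → ℝ → ℝ) (u v : ℝ) : ℝ := ∫ x in (0 : ℝ)..u, p x v

section Slices

variable {u v : ℝ}

lemma continuousOn_slice (hp : IsCopulaDensity p) (hv : v ∈ Icc (0 : ℝ) 1) :
    ContinuousOn (fun u => p u v) (Icc 0 1) :=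
  hp.continuousOn.comp (f := fun u => (u, v)) (by fun_prop) fun _ hu => ⟨hu, hv⟩

lemma intervalIntegrable_slice (hp : IsCopulaDensity p) (hv : v ∈ Icc (0 : ℝ) 1) {a b : ℝ}
    (ha : a ∈ Icc (0 : ℝ) 1) (hb : b ∈ Icc (0 : ℝ) 1) :
    IntervalIntegrable (fun u => p u v) volume a b :=
  ((hp.continuousOn_slice hv).mono (uIcc_subset_Icc ha hb)).intervalIntegrable

lemma hasDerivAt_partialCDF (hp : IsCopulaDensity p) (hu : u ∈ Ioo (0 : ℝ) 1)
    (hv : v ∈ Icc (0 : ℝ) 1) : HasDerivAt (fun u => partialCDF p u v) (p u v) u :=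
  intervalIntegral.integral_hasDerivAt_right
    (hp.intervalIntegrable_slice hv (by simp) (Ioo_subset_Icc_self hu))
    (((hp.continuousOn_slice hv).mono Ioo_subset_Icc_self).stronglyMeasurableAtFilter
      isOpen_Ioo u hu)
    ((hp.continuousOn_slice hv).continuousAt (Icc_mem_nhds hu.1 hu.2))

lemma continuousOn_partialCDF (hp : IsCopulaDensity p) (hv : v ∈ Icc (0 : ℝ) 1) :
    ContinuousOn (fun u => partialCDF p u v) (Icc 0 1) :=
  (intervalIntegral.continuousOn_primitive_interval
    ((uIcc_of_le (zero_le_one' ℝ)).symm ▸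
      (hp.continuousOn_slice hv).integrableOn_Icc)).mono (uIcc_of_le (zero_le_one' ℝ)).ge

lemma partialCDF_zero (v : ℝ) : partialCDF p 0 v = 0 := intervalIntegral.integral_same

lemma partialCDF_one (hp : IsCopulaDensity p) (hv : v ∈ Icc (0 : ℝ) 1) :
    partialCDF p 1 v = 1 := hp.margU v hv

lemma strictMonoOn_partialCDF (hp : IsCopulaDensity p) (hv : v ∈ Icc (0 : ℝ) 1) :
    StrictMonoOn (fun u => partialCDF p u v) (Icc 0 1) := by
  refine strictMonoOn_of_deriv_pos (convex_Icc 0 1) (hp.continuousOn_partialCDF hv)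
    fun u hu => ?_
  rw [interior_Icc] at hu
  rw [(hp.hasDerivAt_partialCDF hu hv).deriv]
  exact hp.pos u (Ioo_subset_Icc_self hu) v hv

lemma partialCDF_mem_Ioo (hp : IsCopulaDensity p) (hu : u ∈ Ioo (0 : ℝ) 1)
    (hv : v ∈ Icc (0 : ℝ) 1) : partialCDF p u v ∈ Ioo (0 : ℝ) 1 := by
  have hm := hp.strictMonoOn_partialCDF hv
  constructor
  · simpa [partialCDF_zero] using hm (by simp) (Ioo_subset_Icc_self hu) hu.1
  · simpa [hp.partialCDF_one hv] using hm (Ioo_subset_Icc_self hu) (by simp) hu.2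

lemma integral_partialCDF (hp : IsCopulaDensity p) (hu : u ∈ Icc (0 : ℝ) 1) :
    ∫ v in (0 : ℝ)..1, partialCDF p u v = u := by
  have hc : ContinuousOn (Function.uncurry p) (Icc 0 u ×ˢ Icc 0 1) :=
    hp.continuousOn.mono (prod_mono (Icc_subset_Icc_right hu.2) Subset.rfl)
  have h := (setIntegral_box_symm hu.1 zero_le_one hc).symm.trans
    (setIntegral_box hu.1 zero_le_one hc)
  simp only [Function.uncurry_apply_pair] at h
  unfold partialCDF
  rw [h, intervalIntegral.integral_congr (g := fun _ => (1 : ℝ)) fun x hx => ?_]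
  · simp
  · rw [uIcc_of_le hu.1] at hx
    exact hp.margV x ⟨hx.1, hx.2.trans hu.2⟩

end Slices

section Liouville

variable {θ : ℝ}

/-- Liouville's equation satisfied by the density in the interior of the unit square. -/
def SatisfiesLiouville (p : ℝ → ℝ → ℝ) (θ : ℝ) : Prop :=
  ∀ z ∈ openUnitSquare, mixedPartial (fun z => Real.log (Function.uncurry p z)) z =
    2 * θ * Function.uncurry p z

/-- The part of the logarithmic derivative `∂ᵥ log p` not explained by `partialCDF`. -/
noncomputable def logDerivOffset (p : ℝ → ℝ → ℝ) (θ v : ℝ) : ℝ :=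
  partialSnd (fun z => Real.log (Function.uncurry p z)) (1 / 2, v)
    - 2 * θ * partialCDF p (1 / 2) v

variable {u v : ℝ}

lemma partialSnd_log_eq (hp : IsCopulaDensity p) (hL : SatisfiesLiouville p θ)
    (hu : u ∈ Ioo (0 : ℝ) 1) (hv : v ∈ Ioo (0 : ℝ) 1) :
    partialSnd (fun z => Real.log (Function.uncurry p z)) (u, v) =
      2 * θ * partialCDF p u v + logDerivOffset p θ v := by
  have hd : ∀ x ∈ Ioo (0 : ℝ) 1, HasDerivAt
      (fun x => partialSnd (fun z => Real.log (Function.uncurry p z)) (x, v)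
        - 2 * θ * partialCDF p x v) 0 x := fun x hx => by
    have h := (hasDerivAt_mixedPartial isOpen_openUnitSquare hp.contDiffOn_log
      (show (x, v) ∈ openUnitSquare from ⟨hx, hv⟩)).sub
      ((hp.hasDerivAt_partialCDF hx (Ioo_subset_Icc_self hv)).const_mul (2 * θ))
    rwa [hL (x, v) ⟨hx, hv⟩, Function.uncurry_apply_pair, sub_self] at h
  have := isOpen_Ioo.is_const_of_deriv_eq_zero isPreconnected_Ioo
    (fun x hx => (hd x hx).differentiableAt.differentiableWithinAt)
    (fun x hx => (hd x hx).deriv) hu (show (1 / 2 : ℝ) ∈ Ioo (0 : ℝ) 1 by norm_num)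
  rw [logDerivOffset]
  linarith

lemma hasDerivAt_slice (hp : IsCopulaDensity p) (hL : SatisfiesLiouville p θ)
    (hu : u ∈ Ioo (0 : ℝ) 1) (hv : v ∈ Ioo (0 : ℝ) 1) :
    HasDerivAt (fun v => p u v) (p u v * (2 * θ * partialCDF p u v + logDerivOffset p θ v)) v := by
  have h := (hasDerivAt_partialSnd isOpen_openUnitSquare hp.contDiffOn_log
    (show (u, v) ∈ openUnitSquare from ⟨hu, hv⟩)).exp
  rw [hp.partialSnd_log_eq hL hu hv] at h
  simp only [Function.uncurry_apply_pair] at h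
  have hpos : ∀ y ∈ Ioo (0 : ℝ) 1, 0 < p u y := fun y hy =>
    hp.pos u (Ioo_subset_Icc_self hu) y (Ioo_subset_Icc_self hy)
  rw [Real.exp_log (hpos v hv)] at h
  refine h.congr_of_eventuallyEq ?_
  filter_upwards [isOpen_Ioo.mem_nhds hv] with y hy
  rw [Real.exp_log (hpos y hy)]

lemma hasDerivAt_partialCDF_right (hp : IsCopulaDensity p) (hL : SatisfiesLiouville p θ)
    (hu : u ∈ Icc (0 : ℝ) 1) (hv : v ∈ Ioo (0 : ℝ) 1) :
    HasDerivAt (fun v => partialCDF p u v)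
      (θ * partialCDF p u v ^ 2 + logDerivOffset p θ v * partialCDF p u v) v := by
  have h0 : (0 : ℝ) ∈ Icc (0 : ℝ) 1 := by simp
  obtain ⟨ε, hε, hs⟩ := Metric.nhds_basis_closedBall.mem_iff.1 (isOpen_Ioo.mem_nhds hv)
  obtain ⟨Mp, hMp⟩ := isCompact_unitSquare.exists_bound_of_continuousOn hp.continuousOn
  have cFv := (contDiffOn_partialSnd isOpen_openUnitSquare hp.contDiffOn_log).continuousOn
  obtain ⟨Mf, hMf⟩ := (isCompact_closedBall v ε).exists_bound_of_continuousOn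
    (cFv.comp (f := fun y => ((1 / 2 : ℝ), y)) (by fun_prop)
      fun y hy => ⟨by norm_num, hs hy⟩)
  have hvI := Ioo_subset_Icc_self hv
  have hsub : Icc 0 u ⊆ Icc (0 : ℝ) 1 := Icc_subset_Icc_right hu.2
  have cH := (hp.continuousOn_partialCDF hvI).mono hsub
  have hF' : ContinuousOn
      (fun x => p x v * (2 * θ * partialCDF p x v + logDerivOffset p θ v)) (Icc 0 u) :=
    ((hp.continuousOn_slice hvI).mono hsub).mul
      ((continuousOn_const.mul cH).add continuousOn_const)
  have hi' := hF'.intervalIntegrable_of_Icc (μ := volume) hu.1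
  have hH : ∀ x ∈ Ioo (0 : ℝ) 1, ∀ y ∈ Ioo (0 : ℝ) 1, |partialCDF p x y| ≤ 1 :=
    fun x hx y hy => by
      have := hp.partialCDF_mem_Ioo hx (Ioo_subset_Icc_self hy)
      exact abs_le.2 ⟨by linarith [this.1], this.2.le⟩
  have hne : ∀ᵐ x : ℝ, x ≠ 1 := by simp [ae_iff]
  have key := (intervalIntegral.hasDerivAt_integral_of_dominated_loc_of_deriv_le (μ := volume)
    (F := fun y x => p x y)
    (F' := fun y x => p x y * (2 * θ * partialCDF p x y + logDerivOffset p θ y))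
    (a := 0) (b := u) (x₀ := v) (bound := fun _ => Mp * (2 * |θ| + (Mf + 2 * |θ|)))
    (Metric.closedBall_mem_nhds v hε) ?_ (hp.intervalIntegrable_slice hvI h0 hu)
    (intervalIntegrable_iff.1 hi').aestronglyMeasurable ?_ intervalIntegrable_const ?_).2
  · refine key.congr_deriv ?_
    rw [intervalIntegral.integral_eq_sub_of_hasDerivAt_of_le hu.1
      (f := fun x => θ * partialCDF p x v ^ 2 + logDerivOffset p θ v * partialCDF p x v)
      ((continuousOn_const.mul (cH.pow 2)).add (continuousOn_const.mul cH)) ?_ hi']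
    · simp [partialCDF_zero]
    · intro x hx
      have hd := hp.hasDerivAt_partialCDF ⟨hx.1, hx.2.trans_le hu.2⟩ hvI
      refine (((hd.pow 2).const_mul θ).add (hd.const_mul _)).congr_deriv ?_
      norm_num
      ring
  · filter_upwards [isOpen_Ioo.mem_nhds hv] with y hy
    exact (intervalIntegrable_iff.1 (hp.intervalIntegrable_slice
      (Ioo_subset_Icc_self hy) h0 hu)).aestronglyMeasurable
  · filter_upwards [hne] with x hx1 hx y hy
    rw [uIoc_of_le hu.1] at hx
    have hx' : x ∈ Ioo (0 : ℝ) 1 := ⟨hx.1, lt_of_le_of_ne (hx.2.trans hu.2) hx1⟩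
    have hp1 : |p x y| ≤ Mp :=
      hMp (x, y) ⟨Ioo_subset_Icc_self hx', Ioo_subset_Icc_self (hs hy)⟩
    have b1 : |2 * θ * partialCDF p x y| ≤ 2 * |θ| := by
      rw [abs_mul, abs_mul, abs_two]
      exact mul_le_of_le_one_right (by positivity) (hH x hx' y (hs hy))
    have b2 : |2 * θ * partialCDF p (1 / 2) y| ≤ 2 * |θ| := by
      rw [abs_mul, abs_mul, abs_two]
      exact mul_le_of_le_one_right (by positivity) (hH _ (by norm_num) y (hs hy))
    have b3 : |logDerivOffset p θ y| ≤ Mf + 2 * |θ| :=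
      (abs_sub _ _).trans (add_le_add (hMf y hy) b2)
    rw [Real.norm_eq_abs, abs_mul]
    exact mul_le_mul hp1 ((abs_add_le _ _).trans (add_le_add b1 b3)) (abs_nonneg _)
      ((abs_nonneg _).trans hp1)
  · filter_upwards [hne] with x hx1 hx y hy
    rw [uIoc_of_le hu.1] at hx
    exact hp.hasDerivAt_slice hL ⟨hx.1, lt_of_le_of_ne (hx.2.trans hu.2) hx1⟩ (hs hy)

lemma logDerivOffset_eq (hp : IsCopulaDensity p) (hL : SatisfiesLiouville p θ)
    (hv : v ∈ Ioo (0 : ℝ) 1) : logDerivOffset p θ v = -θ := by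
  have h := hp.hasDerivAt_partialCDF_right hL (u := 1) (by simp) hv
  have h1 : HasDerivAt (fun v => partialCDF p 1 v) 0 v := by
    refine (hasDerivAt_const v (1 : ℝ)).congr_of_eventuallyEq ?_
    filter_upwards [isOpen_Ioo.mem_nhds hv] with y hy
    exact hp.partialCDF_one (Ioo_subset_Icc_self hy)
  have := h.unique h1
  rw [hp.partialCDF_one (Ioo_subset_Icc_self hv)] at this
  linarith

/-- The partial distribution function solves the logistic equation in its second variable. -/
lemma hasDerivAt_partialCDF_logistic (hp : IsCopulaDensity p) (hL : SatisfiesLiouville p θ)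
    (hu : u ∈ Icc (0 : ℝ) 1) (hv : v ∈ Ioo (0 : ℝ) 1) :
    HasDerivAt (fun v => partialCDF p u v) (θ * (partialCDF p u v ^ 2 - partialCDF p u v)) v :=
  (hp.hasDerivAt_partialCDF_right hL hu hv).congr_deriv (by
    rw [hp.logDerivOffset_eq hL hv]
    ring)

lemma eq_half_of_hasDerivAt_zero {f : ℝ → ℝ} (hf : ∀ x ∈ Ioo (0 : ℝ) 1, HasDerivAt f 0 x)
    {x : ℝ} (hx : x ∈ Ioo (0 : ℝ) 1) : f x = f (1 / 2) :=
  isOpen_Ioo.is_const_of_deriv_eq_zero isPreconnected_Ioo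
    (fun x hx => (hf x hx).differentiableAt.differentiableWithinAt)
    (fun x hx => (hf x hx).deriv) hx (by norm_num)

lemma integral_congr_Ioo_zero_one {f g : ℝ → ℝ} (h : EqOn f g (Ioo 0 1)) :
    ∫ x in (0 : ℝ)..1, f x = ∫ x in (0 : ℝ)..1, g x := by
  refine intervalIntegral.integral_congr_ae ?_
  have hne : ∀ᵐ x : ℝ, x ≠ 1 := by simp [ae_iff]
  filter_upwards [hne] with x hx1 hx
  rw [uIoc_of_le zero_le_one] at hx
  exact h ⟨hx.1, lt_of_le_of_ne hx.2 hx1⟩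

lemma eq_one_of_liouville_zero (hp : IsCopulaDensity p) (hL : SatisfiesLiouville p 0)
    (hu : u ∈ Ioo (0 : ℝ) 1) (hv : v ∈ Ioo (0 : ℝ) 1) : p u v = 1 := by
  have hH : ∀ x ∈ Ioo (0 : ℝ) 1, partialCDF p x v = x := fun x hx => by
    have hx' := Ioo_subset_Icc_self hx
    have hc : ∀ y ∈ Ioo (0 : ℝ) 1, partialCDF p x y = partialCDF p x (1 / 2) := fun y hy =>
      eq_half_of_hasDerivAt_zero (f := fun y => partialCDF p x y)
        (fun y hy => by simpa using hp.hasDerivAt_partialCDF_logistic hL hx' hy) hy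
    have hi := hp.integral_partialCDF hx'
    rw [integral_congr_Ioo_zero_one hc] at hi
    rw [hc v hv]
    simpa using hi
  refine (hp.hasDerivAt_partialCDF hu (Ioo_subset_Icc_self hv)).unique
    ((hasDerivAt_id' u).congr_of_eventuallyEq ?_)
  filter_upwards [isOpen_Ioo.mem_nhds hu] with x hx using hH x hx

lemma frank_denom_ne_zero (hθ : θ ≠ 0) (hu : u ∈ Icc (0 : ℝ) 1) :
    1 - Real.exp (-θ) - (1 - Real.exp (-θ * u)) * (1 - Real.exp (-θ * v)) ≠ 0 := by
  have e : 1 - Real.exp (-θ) - (1 - Real.exp (-θ * u)) * (1 - Real.exp (-θ * v)) =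
      (Real.exp (-θ * u) - Real.exp (-θ)) + (1 - Real.exp (-θ * u)) * Real.exp (-θ * v) := by
    ring
  have hy := Real.exp_pos (-θ * v)
  rw [e]
  rcases hθ.lt_or_gt with h | h
  · have h1 : Real.exp (-θ * u) ≤ Real.exp (-θ) := Real.exp_le_exp.2 (by nlinarith [hu.2])
    have h2 : 1 ≤ Real.exp (-θ * u) := Real.one_le_exp (by nlinarith [hu.1])
    have h3 : 1 < Real.exp (-θ) := Real.one_lt_exp_iff.2 (by linarith)
    rcases h2.eq_or_lt with h2 | h2
    · rw [← h2]; linarith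
    · nlinarith
  · have h1 : Real.exp (-θ) ≤ Real.exp (-θ * u) := Real.exp_le_exp.2 (by nlinarith [hu.2])
    have h2 : Real.exp (-θ * u) ≤ 1 := Real.exp_le_one_iff.2 (by nlinarith [hu.1])
    have h3 : Real.exp (-θ) < 1 := Real.exp_lt_one_iff.2 (by linarith)
    rcases h2.eq_or_lt with h2 | h2
    · rw [h2]; linarith
    · nlinarith

lemma integral_logistic (hθ : θ ≠ 0) {k : ℝ} (hk : 0 < k) :
    ∫ y in (0 : ℝ)..1, 1 / (1 + k * Real.exp (θ * y)) =
      1 - (Real.log (1 + k * Real.exp θ) - Real.log (1 + k)) / θ := by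
  have hpos : ∀ y, 0 < 1 + k * Real.exp (θ * y) := fun y => by positivity
  have hd : ∀ y, HasDerivAt (fun y => y - Real.log (1 + k * Real.exp (θ * y)) / θ)
      (1 / (1 + k * Real.exp (θ * y))) y := fun y => by
    have := ((((hasDerivAt_id' y).const_mul θ).exp.const_mul k).const_add 1).log (hpos y).ne'
    refine ((hasDerivAt_id' y).sub (this.div_const θ)).congr_deriv ?_
    have := (hpos y).ne'
    field_simp
    ring
  have hc : Continuous fun y => 1 / (1 + k * Real.exp (θ * y)) :=
    continuous_const.div (by fun_prop) fun y => (hpos y).ne'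
  rw [intervalIntegral.integral_eq_sub_of_hasDerivAt (fun y _ => hd y)
    (hc.intervalIntegrable _ _)]
  simp only [mul_one, mul_zero, Real.exp_zero]
  ring

/-- The partial distribution function is the one of the Frank copula. -/
lemma partialCDF_eq_frank (hp : IsCopulaDensity p) (hθ : θ ≠ 0) (hL : SatisfiesLiouville p θ)
    (hu : u ∈ Ioo (0 : ℝ) 1) (hv : v ∈ Ioo (0 : ℝ) 1) :
    partialCDF p u v = (1 - Real.exp (-θ * u)) * Real.exp (-θ * v) /
      (1 - Real.exp (-θ) - (1 - Real.exp (-θ * u)) * (1 - Real.exp (-θ * v))) := by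
  have hu' := Ioo_subset_Icc_self hu
  have hH : ∀ y ∈ Ioo (0 : ℝ) 1, partialCDF p u y ∈ Ioo (0 : ℝ) 1 := fun y hy =>
    hp.partialCDF_mem_Ioo hu (Ioo_subset_Icc_self hy)
  have hconst := fun y (hy : y ∈ Ioo (0 : ℝ) 1) => eq_half_of_hasDerivAt_zero
    (f := fun y => ((partialCDF p u y)⁻¹ - 1) * Real.exp (-θ * y)) (fun y hy => by
      have hne := (hH y hy).1.ne'
      refine ((((hp.hasDerivAt_partialCDF_logistic hL hu' hy).inv hne).sub_const 1).mul
        ((hasDerivAt_id' y).const_mul (-θ)).exp).congr_deriv ?_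
      simp only [Pi.inv_apply]
      field_simp
      ring) hy
  set k := ((partialCDF p u (1 / 2))⁻¹ - 1) * Real.exp (-θ * (1 / 2)) with hkdef
  have hk : 0 < k := by
    have := hH (1 / 2) (by norm_num)
    exact mul_pos (sub_pos.2 ((one_lt_inv₀ this.1).2 this.2)) (Real.exp_pos _)
  have hform : ∀ y ∈ Ioo (0 : ℝ) 1, partialCDF p u y = 1 / (1 + k * Real.exp (θ * y)) :=
    fun y hy => by
      have h := hconst y hy
      have hne := (hH y hy).1.ne'
      rw [← h, mul_assoc, ← Real.exp_add, neg_mul, neg_add_cancel, Real.exp_zero, mul_one,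
        add_sub_cancel, one_div, inv_inv]
  have hi := hp.integral_partialCDF hu'
  rw [integral_congr_Ioo_zero_one hform, integral_logistic hθ hk] at hi
  have hlog : Real.log (1 + k * Real.exp θ) = Real.log (1 + k) + θ * (1 - u) := by
    field_simp at hi
    linarith
  have hexp : 1 + k * Real.exp θ = (1 + k) * Real.exp (θ * (1 - u)) := by
    have := congrArg Real.exp hlog
    rwa [Real.exp_add, Real.exp_log (by positivity), Real.exp_log (by positivity)] at this
  have hE : Real.exp (-θ) + k = (1 + k) * Real.exp (-θ * u) := by
    have h1 : Real.exp (-θ) * Real.exp θ = 1 := by rw [← Real.exp_add]; simp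
    have h2 : Real.exp (-θ * u) = Real.exp (-θ) * Real.exp (θ * (1 - u)) := by
      rw [← Real.exp_add]; ring_nf
    rw [h2]
    linear_combination Real.exp (-θ) * hexp - k * h1
  have hy : Real.exp (θ * v) * Real.exp (-θ * v) = 1 := by rw [← Real.exp_add]; simp
  have hpos : 0 < 1 + k * Real.exp (θ * v) := by positivity
  rw [hform v hv, div_eq_div_iff hpos.ne' (frank_denom_ne_zero hθ hu')]
  linear_combination (-1 : ℝ) * hE - k * (1 - Real.exp (-θ * u)) * hy

lemma eq_frankDensity_of_mem_Ioo (hp : IsCopulaDensity p) (hθ : θ ≠ 0)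
    (hL : SatisfiesLiouville p θ) (hu : u ∈ Ioo (0 : ℝ) 1) (hv : v ∈ Ioo (0 : ℝ) 1) :
    p u v = frankDensity θ u v := by
  have hD := frank_denom_ne_zero (v := v) hθ (Ioo_subset_Icc_self hu)
  have hx := ((hasDerivAt_id' u).const_mul (-θ)).exp.const_sub 1
  have hF := (hx.mul_const (Real.exp (-θ * v))).div
    ((hx.mul_const (1 - Real.exp (-θ * v))).const_sub (1 - Real.exp (-θ))) hD
  have h := (hp.hasDerivAt_partialCDF hu (Ioo_subset_Icc_self hv)).unique
    (hF.congr_of_eventuallyEq (by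
      filter_upwards [isOpen_Ioo.mem_nhds hu] with x hx
      exact hp.partialCDF_eq_frank hθ hL hx hv))
  rw [h, frankDensity, mul_add, Real.exp_add]
  congr 1
  ring

lemma eqOn_unitSquare {F : ℝ × ℝ → ℝ} (hp : IsCopulaDensity p) (hF : ContinuousOn F unitSquare)
    (h : EqOn (Function.uncurry p) F openUnitSquare) : EqOn (Function.uncurry p) F unitSquare :=
  h.of_subset_closure hp.continuousOn hF openUnitSquare_subset (by
    rw [closure_prod_eq, closure_Ioo zero_ne_one])

/-- A copula density solving Liouville's equation with `θ ≠ 0` is a Frank density. -/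
theorem eq_frankDensity (hp : IsCopulaDensity p) (hθ : θ ≠ 0) (hL : SatisfiesLiouville p θ)
    (hu : u ∈ Icc (0 : ℝ) 1) (hv : v ∈ Icc (0 : ℝ) 1) : p u v = frankDensity θ u v := by
  refine hp.eqOn_unitSquare (F := fun z => frankDensity θ z.1 z.2) ?_
    (fun z hz => hp.eq_frankDensity_of_mem_Ioo hθ hL hz.1 hz.2)
    (show (u, v) ∈ unitSquare from ⟨hu, hv⟩)
  unfold frankDensity
  exact ContinuousOn.div (by fun_prop) (by fun_prop)
    fun z hz => pow_ne_zero 2 (frank_denom_ne_zero hθ hz.1)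

lemma integral_integral_sign :
    ∫ v in (0 : ℝ)..1, ∫ v' in (0 : ℝ)..1, Real.sign (v - v') = 0 := by
  have hi : Integrable (Function.uncurry fun v v' : ℝ => Real.sign (v - v')) squareMeasure :=
    (integrable_const (1 : ℝ)).mono'
      (measurable_realSign.comp (by fun_prop)).aestronglyMeasurable
      (.of_forall fun z => abs_realSign_le _)
  simp only [integral_zero_one]
  have h := integral_integral_swap hi
  have e : ∀ x y : ℝ, Real.sign (x - y) = -Real.sign (y - x) := fun x y => by
    rw [← Real.sign_neg, neg_sub]
  have h2 : ∫ y, ∫ x, Real.sign (x - y) ∂intervalMeasure ∂intervalMeasure =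
      -∫ y, ∫ x, Real.sign (y - x) ∂intervalMeasure ∂intervalMeasure := by
    simp only [← integral_neg]
    exact integral_congr_ae (.of_forall fun y => integral_congr_ae (.of_forall fun x => e x y))
  linarith

/-- Kendall's τ of the independence copula vanishes. -/
lemma kendallTau_eq_zero {p : ℝ → ℝ → ℝ}
    (h : ∀ u ∈ Icc (0 : ℝ) 1, ∀ v ∈ Icc (0 : ℝ) 1, p u v = 1) : kendallTau p = 0 := by
  have hI : uIcc (0 : ℝ) 1 = Icc 0 1 := uIcc_of_le zero_le_one
  have e : kendallTau p = ∫ u in (0 : ℝ)..1, ∫ v in (0 : ℝ)..1, ∫ u' in (0 : ℝ)..1,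
      ∫ v' in (0 : ℝ)..1, Real.sign (u - u') * Real.sign (v - v') := by
    refine intervalIntegral.integral_congr fun u hu => intervalIntegral.integral_congr fun v hv =>
      intervalIntegral.integral_congr fun u' hu' => intervalIntegral.integral_congr fun v' hv' => ?_
    rw [hI] at hu hv hu' hv'
    simp only [h u hu v hv, h u' hu' v' hv', mul_one]
  rw [e]
  simp only [intervalIntegral.integral_const_mul, intervalIntegral.integral_mul_const,
    integral_integral_sign, mul_zero, intervalIntegral.integral_zero]

end Liouville

end IsCopulaDensity

/-- The MICK (minimum information copula under fixed Kendall's τ, `τ ≠ 0`) is the Frank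
copula density with parameter `θ = 4λ`, where `λ` is the Lagrange multiplier in the
stationarity equation `∂²/∂u∂v log p = 8λ p`. -/
theorem mick_eq_frank (τ : ℝ) (hτ : τ ∈ Set.Ioo (-1 : ℝ) 1) (hτ0 : τ ≠ 0)
    (p : ℝ → ℝ → ℝ) (hp : IsCopulaDensity p) (hK : kendallTau p = τ)
    (hmin : ∀ q : ℝ → ℝ → ℝ, IsCopulaDensity q → kendallTau q = τ →
      shannonInfo p ≤ shannonInfo q) :
    ∃ θ : ℝ, θ ≠ 0 ∧
      (∃ lam : ℝ, θ = 4 * lam ∧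
        ∀ u ∈ Set.Ioo (0 : ℝ) 1, ∀ v ∈ Set.Ioo (0 : ℝ) 1,
          deriv (fun u' => deriv (fun v' => Real.log (p u' v')) v) u = 8 * lam * p u v) ∧
      (∀ u ∈ Set.Icc (0 : ℝ) 1, ∀ v ∈ Set.Icc (0 : ℝ) 1, p u v = frankDensity θ u v) := by
  obtain ⟨c, hc⟩ := hp.exists_mixedPartial_log_eq fun q hq hqK => hmin q hq (hqK.trans hK)
  have hL : IsCopulaDensity.SatisfiesLiouville p (c / 2) := fun z hz => by
    rw [hc z hz]
    ring
  have hθ : c / 2 ≠ 0 := by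
    intro h0
    rw [h0] at hL
    refine hτ0 (hK.symm.trans (IsCopulaDensity.kendallTau_eq_zero fun u hu v hv => ?_))
    exact hp.eqOn_unitSquare (F := fun _ => 1) continuousOn_const
      (fun z hz => hp.eq_one_of_liouville_zero hL hz.1 hz.2)
      (show (u, v) ∈ MICK.unitSquare from ⟨hu, hv⟩)
  refine ⟨c / 2, hθ, ⟨c / 8, by ring, fun u hu v hv => ?_⟩, fun u hu v hv =>
    hp.eq_frankDensity hθ hL hu hv⟩
  have hd := MICK.hasDerivAt_mixedPartial MICK.isOpen_openUnitSquare hp.contDiffOn_log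
    (show (u, v) ∈ MICK.openUnitSquare from ⟨hu, hv⟩)
  refine (hd.congr_of_eventuallyEq ?_).deriv.trans ?_
  · filter_upwards [isOpen_Ioo.mem_nhds hu] with x hx
    exact (MICK.hasDerivAt_partialSnd MICK.isOpen_openUnitSquare hp.contDiffOn_log
      (show (x, v) ∈ MICK.openUnitSquare from ⟨hx, hv⟩)).deriv
  · rw [hc (u, v) ⟨hu, hv⟩, Function.uncurry_apply_pair]
    ring
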